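/- arXiv:2604.19020 — 2 statements merged into one kernel-verified Lean document; each statement's English description precedes it below -/
import Mathlib

section
/- Assume f satisfies condition (OSC). If u is a strictly convex solution of the second boundary value problem with data (f, c), then for every x ∈ Ω one has f(x, ∇u(x)) + c ≥ (n/2)·(|Ω̃|/|Ω|)^{1/n}; equivalently, the Minkowski mean curvature div(∇u/√(1 − |∇u|²)) of the graph of u is bounded below on Ω by (n/2)·(|Ω̃|/|Ω|)^{1/n}. -/
open Set MeasureTheory Matrix
open scoped Topology RealInnerProductSpace NNReal

noncomputable section

abbrev Euc (n : ℕ) := EuclideanSpace ℝ (Fin n)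

variable {n : ℕ}

/-- Hessian matrix of `u` at `x`. -/
def Hess (u : Euc n → ℝ) (x : Euc n) : Matrix (Fin n) (Fin n) ℝ :=
  fun i j => iteratedFDeriv ℝ 2 u x ![EuclideanSpace.single i 1, EuclideanSpace.single j 1]

/-- `A ≤ B` in the sense of symmetric matrices. -/
def MatLE (A B : Matrix (Fin n) (Fin n) ℝ) : Prop := (B - A).PosSemidef

/-- The Minkowski mean-curvature operator `div (∇u / √(1 - |∇u|²))`. -/
def MinkDiv (u : Euc n → ℝ) (x : Euc n) : ℝ :=
  ∑ i, fderiv ℝ (fun y => (Real.sqrt (1 - ‖gradient u y‖ ^ 2))⁻¹ * gradient u y i) x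
    (EuclideanSpace.single i 1)

/-- The Euclidean mean-curvature operator `div (∇u / √(1 + |∇u|²))`. -/
def EucDiv (u : Euc n → ℝ) (x : Euc n) : ℝ :=
  ∑ i, fderiv ℝ (fun y => (Real.sqrt (1 + ‖gradient u y‖ ^ 2))⁻¹ * gradient u y i) x
    (EuclideanSpace.single i 1)

/-- `S(p) = (1/v)(Iₙ + p pᵀ / v²)`, `v = √(1-|p|²)`. -/
def Smat (p : Euc n) : Matrix (Fin n) (Fin n) ℝ :=
  (Real.sqrt (1 - ‖p‖ ^ 2))⁻¹ •
    ((1 : Matrix (Fin n) (Fin n) ℝ) +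
      (1 - ‖p‖ ^ 2)⁻¹ • Matrix.vecMulVec (fun i => p i) (fun j => p j))

/-- `B(p) = Iₙ + p pᵀ / (v (1 + v))`, `v = √(1-|p|²)`. -/
def Bmat (p : Euc n) : Matrix (Fin n) (Fin n) ℝ :=
  (1 : Matrix (Fin n) (Fin n) ℝ) +
    (Real.sqrt (1 - ‖p‖ ^ 2) * (1 + Real.sqrt (1 - ‖p‖ ^ 2)))⁻¹ •
      Matrix.vecMulVec (fun i => p i) (fun j => p j)

/-- `A(x) = (1/v)·B(∇u)·D²u·B(∇u)`: its eigenvalues are the principal curvatures. -/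
def Amat (u : Euc n → ℝ) (x : Euc n) : Matrix (Fin n) (Fin n) ℝ :=
  (Real.sqrt (1 - ‖gradient u x‖ ^ 2))⁻¹ •
    (Bmat (gradient u x) * Hess u x * Bmat (gradient u x))

/-- supremum of the quadratic form of `A` over the unit sphere (the operator
norm / largest eigenvalue for a positive semidefinite symmetric `A`). -/
def quadSup (A : Matrix (Fin n) (Fin n) ℝ) : ℝ :=
  ⨆ ξ : Metric.sphere (0 : Euc n) 1,
    (fun i => (ξ : Euc n) i) ⬝ᵥ A.mulVec (fun i => (ξ : Euc n) i)

/-- The domains `Ω = {h̃ > 0}`, `Ω̃ = {h > 0}` are bounded uniformly convex domains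
with smooth boundary, described by the defining functions `h̃` and `h`. -/
def DomainSetup (Ω Ωt : Set (Euc n)) (ht h : Euc n → ℝ) (θt θ : ℝ) : Prop :=
  IsOpen Ω ∧ IsOpen Ωt ∧ Bornology.IsBounded Ω ∧ Bornology.IsBounded Ωt ∧
  Ω.Nonempty ∧ Ωt.Nonempty ∧
  ContDiff ℝ (⊤ : ℕ∞) ht ∧ ContDiff ℝ (⊤ : ℕ∞) h ∧
  Ω = {x | 0 < ht x} ∧ Ωt = {y | 0 < h y} ∧
  (∀ x ∈ frontier Ω, ‖gradient ht x‖ = 1) ∧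
  (∀ y ∈ frontier Ωt, ‖gradient h y‖ = 1) ∧
  0 < θt ∧ 0 < θ ∧
  (∀ x : Euc n, MatLE (Hess ht x) ((-θt) • (1 : Matrix (Fin n) (Fin n) ℝ))) ∧
  (∀ y : Euc n, MatLE (Hess h y) ((-θ) • (1 : Matrix (Fin n) (Fin n) ℝ)))

/-- `f ∈ 𝒜`: `f` is `C²` on `Ω̄ × closure Ω̃` and concave in `x`. -/
def InA (Ω Ωt : Set (Euc n)) (f : Euc n × Euc n → ℝ) : Prop :=
  ContDiffOn ℝ 2 f (closure Ω ×ˢ closure Ωt) ∧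
  ∀ p ∈ closure Ωt, ConcaveOn ℝ (closure Ω) (fun x => f (x, p))

/-- Condition (OSC): `osc f ≤ (n/2)(|Ω̃|/|Ω|)^{1/n}`. -/
def OSCcond (Ω Ωt : Set (Euc n)) (f : Euc n × Euc n → ℝ) : Prop :=
  ∀ x ∈ closure Ω, ∀ y ∈ closure Ω, ∀ p ∈ closure Ωt, ∀ q ∈ closure Ωt,
    |f (x, p) - f (y, q)| ≤
      ((n : ℝ) / 2) * ((volume Ωt).toReal / (volume Ω).toReal) ^ ((1 : ℝ) / n)

/-- `‖f‖_{C²(Ω̄ × closure Ω̃)} ≤ K`. -/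
def C2Bound (Ω Ωt : Set (Euc n)) (f : Euc n × Euc n → ℝ) (K : ℝ) : Prop :=
  ContDiffOn ℝ 2 f (closure Ω ×ˢ closure Ωt) ∧
  ∀ z ∈ closure Ω ×ˢ closure Ωt,
    |f z| ≤ K ∧ ‖fderiv ℝ f z‖ ≤ K ∧ ‖iteratedFDeriv ℝ 2 f z‖ ≤ K

/-- `sup |D_x f| ≤ ε` on `Ω̄ × closure Ω̃`. -/
def DxBound (Ω Ωt : Set (Euc n)) (f : Euc n × Euc n → ℝ) (ε : ℝ) : Prop :=
  ∀ x ∈ closure Ω, ∀ p ∈ closure Ωt, ‖fderiv ℝ (fun x' => f (x', p)) x‖ ≤ ε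

/-- `sup |D_{xp} f| ≤ ε` on `Ω̄ × closure Ω̃`. -/
def DxpBound (Ω Ωt : Set (Euc n)) (f : Euc n × Euc n → ℝ) (ε : ℝ) : Prop :=
  ∀ x ∈ closure Ω, ∀ p ∈ closure Ωt,
    ‖fderiv ℝ (fun p' => fderiv ℝ (fun x' => f (x', p')) x) p‖ ≤ ε

/-- A strictly convex solution of the second boundary value problem. -/
def IsStrictSol (Ω Ωt : Set (Euc n)) (f : Euc n × Euc n → ℝ) (c : ℝ) (u : Euc n → ℝ) : Prop :=
  ContDiffOn ℝ 2 u (closure Ω) ∧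
  (∀ x ∈ closure Ω, (Hess u x).PosDef) ∧
  (∀ x ∈ closure Ω, ‖gradient u x‖ < 1) ∧
  (∀ x ∈ Ω, MinkDiv u x = f (x, gradient u x) + c) ∧
  gradient u '' Ω = Ωt

/-- A smooth uniformly convex solution of the second boundary value problem. -/
def IsSmoothSol (Ω Ωt : Set (Euc n)) (f : Euc n × Euc n → ℝ) (c : ℝ) (u : Euc n → ℝ) : Prop :=
  ContDiffOn ℝ (⊤ : ℕ∞) u (closure Ω) ∧
  (∃ δ : ℝ, 0 < δ ∧ ∀ x ∈ closure Ω, MatLE (δ • (1 : Matrix (Fin n) (Fin n) ℝ)) (Hess u x)) ∧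
  (∀ x ∈ closure Ω, ‖gradient u x‖ < 1) ∧
  (∀ x ∈ Ω, MinkDiv u x = f (x, gradient u x) + c) ∧
  gradient u '' Ω = Ωt

/-- A uniformly convex `C^{2}` solution of the second boundary value problem. -/
def IsUCSol (Ω Ωt : Set (Euc n)) (f : Euc n × Euc n → ℝ) (c : ℝ) (u : Euc n → ℝ) : Prop :=
  ContDiffOn ℝ 2 u (closure Ω) ∧
  (∃ δ : ℝ, 0 < δ ∧ ∀ x ∈ closure Ω, MatLE (δ • (1 : Matrix (Fin n) (Fin n) ℝ)) (Hess u x)) ∧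
  (∀ x ∈ closure Ω, ‖gradient u x‖ < 1) ∧
  (∀ x ∈ Ω, MinkDiv u x = f (x, gradient u x) + c) ∧
  gradient u '' Ω = Ωt

/-- A uniformly convex `C^{4,α}` solution of the second boundary value problem
for the Minkowski mean-curvature operator. -/
def IsC4Sol (Ω Ωt : Set (Euc n)) (f : Euc n × Euc n → ℝ) (c : ℝ) (u : Euc n → ℝ)
    (α : ℝ) : Prop :=
  ContDiffOn ℝ 4 u (closure Ω) ∧
  (∃ C : ℝ≥0, HolderOnWith C (Real.toNNReal α) (fun x => iteratedFDeriv ℝ 4 u x) (closure Ω)) ∧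
  (∃ δ : ℝ, 0 < δ ∧ ∀ x ∈ closure Ω, MatLE (δ • (1 : Matrix (Fin n) (Fin n) ℝ)) (Hess u x)) ∧
  (∀ x ∈ closure Ω, ‖gradient u x‖ < 1) ∧
  (∀ x ∈ Ω, MinkDiv u x = f (x, gradient u x) + c) ∧
  gradient u '' Ω = Ωt

/-- A uniformly convex `C^{4,α}` solution of the second boundary value problem
for the Euclidean mean-curvature operator. -/
def IsC4SolE (Ω Ωt : Set (Euc n)) (f : Euc n × Euc n → ℝ) (c : ℝ) (u : Euc n → ℝ)
    (α : ℝ) : Prop :=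
  ContDiffOn ℝ 4 u (closure Ω) ∧
  (∃ C : ℝ≥0, HolderOnWith C (Real.toNNReal α) (fun x => iteratedFDeriv ℝ 4 u x) (closure Ω)) ∧
  (∃ δ : ℝ, 0 < δ ∧ ∀ x ∈ closure Ω, MatLE (δ • (1 : Matrix (Fin n) (Fin n) ℝ)) (Hess u x)) ∧
  (∀ x ∈ Ω, EucDiv u x = f (x, gradient u x) + c) ∧
  gradient u '' Ω = Ωt

/-- `ũ` is the Legendre transform of `u`. -/
def IsLegendre (Ω Ωt : Set (Euc n)) (u ut : Euc n → ℝ) : Prop :=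
  ContDiffOn ℝ (⊤ : ℕ∞) ut (closure Ωt) ∧
  (∀ x ∈ closure Ω, ut (gradient u x) = ⟪x, gradient u x⟫ - u x) ∧
  (∀ x ∈ closure Ω, gradient ut (gradient u x) = x) ∧
  (∀ x ∈ closure Ω, Hess ut (gradient u x) = (Hess u x)⁻¹)

/-- AM-GM inequality for the eigenvalues of a positive definite matrix. -/
theorem Matrix.PosDef.card_mul_det_rpow_le_trace {n : ℕ} (hn : n ≠ 0)
    {A : Matrix (Fin n) (Fin n) ℝ} (hA : A.PosDef) :
    (n : ℝ) * A.det ^ ((1 : ℝ) / n) ≤ A.trace := by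
  have hn' : (n : ℝ) ≠ 0 := by exact_mod_cast hn
  have hpos := fun i => (hA.eigenvalues_pos i).le
  have key := Real.geom_mean_le_arith_mean_weighted Finset.univ (fun _ : Fin n => (1 : ℝ) / n)
    hA.1.eigenvalues (fun _ _ => by positivity) (by simp [hn']) (fun i _ => hpos i)
  rw [Real.finsetProd_rpow _ _ (fun i _ => hpos i), ← Finset.mul_sum] at key
  have hdet : A.det = ∏ i, hA.1.eigenvalues i := by
    simpa using hA.1.det_eq_prod_eigenvalues
  have htr : A.trace = ∑ i, hA.1.eigenvalues i := by
    simpa using hA.1.trace_eq_sum_eigenvalues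
  rw [hdet, htr]
  calc _ ≤ (n : ℝ) * (1 / n * ∑ i, hA.1.eigenvalues i) := by gcongr
    _ = _ := by field_simp

theorem Hess_eq_fderiv_gradient {u : Euc n → ℝ} {x : Euc n} (i j : Fin n)
    (hu : DifferentiableAt ℝ (gradient u) x) :
    Hess u x i j = fderiv ℝ (gradient u) x (EuclideanSpace.single i 1) j := by
  have h1 : fderiv ℝ u = fun y => innerSL ℝ (gradient u y) := by
    ext y v
    simp
  have h2 : fderiv ℝ (fderiv ℝ u) x = (innerSL ℝ).comp (fderiv ℝ (gradient u) x) := by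
    conv_lhs => rw [h1]
    exact ((innerSL ℝ).hasFDerivAt.comp x hu.hasFDerivAt).fderiv
  rw [Hess, iteratedFDeriv_two_apply, h2]
  simp [EuclideanSpace.inner_single_right]

theorem det_fderiv_gradient {u : Euc n → ℝ} {x : Euc n}
    (hu : DifferentiableAt ℝ (gradient u) x) :
    (fderiv ℝ (gradient u) x).det = (Hess u x).det := by
  rw [ContinuousLinearMap.det, ← LinearMap.det_toMatrix (EuclideanSpace.basisFun (Fin n) ℝ).toBasis,
    ← Matrix.det_transpose]
  congr 1
  ext i j
  simp [LinearMap.toMatrix_apply, Hess_eq_fderiv_gradient i j hu]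

theorem differentiableAt_gradient {u : Euc n → ℝ} {x : Euc n} (hu : ContDiffAt ℝ 2 u x) :
    DifferentiableAt ℝ (gradient u) x := by
  have h := (hu.fderiv_right (m := 1) (by norm_num)).differentiableAt (by norm_num)
  refine differentiableAt_euclidean.2 fun i => ?_
  have hi : (fun y => gradient u y i) = fun y => fderiv ℝ u y (EuclideanSpace.single i 1) := by
    funext y
    simp [← inner_gradient_left, EuclideanSpace.inner_single_right]
  rw [hi]
  exact h.clm_apply (differentiableAt_const _)

/-- The Minkowski mean curvature in terms of the Hessian. -/
theorem MinkDiv_eq {u : Euc n → ℝ} {x : Euc n} (hu : DifferentiableAt ℝ (gradient u) x)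
    (hx : ‖gradient u x‖ < 1) :
    MinkDiv u x = (Real.sqrt (1 - ‖gradient u x‖ ^ 2))⁻¹ * (Hess u x).trace +
      ((Real.sqrt (1 - ‖gradient u x‖ ^ 2)) ^ 3)⁻¹ *
        ((gradient u x).ofLp ⬝ᵥ (Hess u x *ᵥ (gradient u x).ofLp)) := by
  have hpos : 0 < 1 - ‖gradient u x‖ ^ 2 := by nlinarith [norm_nonneg (gradient u x)]
  have hsq : 0 < Real.sqrt (1 - ‖gradient u x‖ ^ 2) := Real.sqrt_pos.2 hpos
  have hg := hu.hasFDerivAt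
  have hs := ((hg.norm_sq.const_sub 1).sqrt hpos.ne')
  have hcoord : ∀ i, HasFDerivAt (fun y => gradient u y i)
      ((EuclideanSpace.proj i : Euc n →L[ℝ] ℝ).comp (fderiv ℝ (gradient u) x)) x :=
    fun i => (EuclideanSpace.proj i : Euc n →L[ℝ] ℝ).hasFDerivAt.comp x hg
  have hinv := (hasDerivAt_inv hsq.ne').comp_hasFDerivAt x hs
  have hterm : ∀ i, fderiv ℝ
      (fun y => (Real.sqrt (1 - ‖gradient u y‖ ^ 2))⁻¹ * gradient u y i) x
      (EuclideanSpace.single i 1) =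
      (Real.sqrt (1 - ‖gradient u x‖ ^ 2))⁻¹ * Hess u x i i +
      ((Real.sqrt (1 - ‖gradient u x‖ ^ 2)) ^ 3)⁻¹ *
        (gradient u x i * (Hess u x *ᵥ (gradient u x).ofLp) i) := by
    intro i
    have := (hinv.mul (hcoord i)).fderiv
    simp only [Function.comp_def] at this
    rw [Pi.mul_def] at this
    rw [this]
    have hi : inner ℝ (gradient u x) (fderiv ℝ (gradient u) x (EuclideanSpace.single i 1)) =
        (Hess u x *ᵥ (gradient u x).ofLp) i := by
      simp only [PiLp.inner_apply, Matrix.mulVec, dotProduct, Hess_eq_fderiv_gradient _ _ hu]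
      simp
    simp [hi, ← Hess_eq_fderiv_gradient _ _ hu]
    field_simp
  rw [MinkDiv, Finset.sum_congr rfl fun i _ => hterm i, Finset.sum_add_distrib,
    ← Finset.mul_sum, ← Finset.mul_sum]
  rfl

theorem trace_Hess_le_MinkDiv {u : Euc n → ℝ} {x : Euc n}
    (hu : DifferentiableAt ℝ (gradient u) x) (hx : ‖gradient u x‖ < 1)
    (hH : (Hess u x).PosSemidef) : (Hess u x).trace ≤ MinkDiv u x := by
  rw [MinkDiv_eq hu hx]
  have hpos : 0 < 1 - ‖gradient u x‖ ^ 2 := by nlinarith [norm_nonneg (gradient u x)]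
  have hsq : 0 < Real.sqrt (1 - ‖gradient u x‖ ^ 2) := Real.sqrt_pos.2 hpos
  have hle : Real.sqrt (1 - ‖gradient u x‖ ^ 2) ≤ 1 :=
    Real.sqrt_le_one.2 (by nlinarith [sq_nonneg ‖gradient u x‖])
  have hone : 1 ≤ (Real.sqrt (1 - ‖gradient u x‖ ^ 2))⁻¹ := (one_le_inv₀ hsq).2 hle
  have hq : 0 ≤ (gradient u x).ofLp ⬝ᵥ (Hess u x *ᵥ (gradient u x).ofLp) := by
    simpa using hH.dotProduct_mulVec_nonneg (gradient u x).ofLp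
  have h1 := le_mul_of_one_le_left hH.trace_nonneg hone
  have h2 : 0 ≤ ((Real.sqrt (1 - ‖gradient u x‖ ^ 2)) ^ 3)⁻¹ *
      ((gradient u x).ofLp ⬝ᵥ (Hess u x *ᵥ (gradient u x).ofLp)) := by positivity
  linarith

/-- A differentiable map has Jacobian determinant at least the ratio of the volumes of its image
and its domain at some point. -/
theorem exists_volume_image_div_le_abs_det_fderiv {s : Set (Euc n)} {g : Euc n → Euc n}
    (hs : IsOpen s) (hne : s.Nonempty) (hfin : volume s ≠ ⊤) (hfin' : volume (g '' s) ≠ ⊤)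
    (hg : ∀ x ∈ s, DifferentiableAt ℝ g x) :
    ∃ x ∈ s, (volume (g '' s)).toReal / (volume s).toReal ≤ |(fderiv ℝ g x).det| := by
  by_contra! hcon
  have hs0 : volume s ≠ 0 := (hs.measure_pos volume hne).ne'
  set r := (volume (g '' s)).toReal / (volume s).toReal
  have himage := addHaar_image_le_lintegral_abs_det_fderiv volume hs.measurableSet
    (fun x hx => (hg x hx).hasFDerivAt.hasFDerivWithinAt (s := s))
  have hlt : ∫⁻ x in s, ENNReal.ofReal |(fderiv ℝ g x).det| < ∫⁻ _ in s, ENNReal.ofReal r := by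
    refine setLIntegral_strict_mono hs.measurableSet hs0 measurable_const
      ((lt_of_le_of_lt (setLIntegral_mono measurable_const fun x hx =>
        ENNReal.ofReal_le_ofReal (hcon x hx).le) ?_).ne) ?_
    · rw [setLIntegral_const]
      exact ENNReal.mul_lt_top ENNReal.ofReal_lt_top hfin.lt_top
    · exact Filter.Eventually.of_forall fun x hx =>
        (ENNReal.ofReal_lt_ofReal_iff ((abs_nonneg _).trans_lt (hcon x hx))).2 (hcon x hx)
  rw [setLIntegral_const, ENNReal.ofReal_div_of_pos (ENNReal.toReal_pos hs0 hfin),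
    ENNReal.ofReal_toReal hfin, ENNReal.ofReal_toReal hfin', ENNReal.div_mul_cancel hs0 hfin] at hlt
  exact absurd himage hlt.not_ge

theorem statement_2 {n : ℕ} (hn : 2 ≤ n)
    (Ω Ωt : Set (Euc n)) (ht h : Euc n → ℝ) (θt θ : ℝ)
    (hdom : DomainSetup Ω Ωt ht h θt θ)
    (hball : closure Ωt ⊆ Metric.ball (0 : Euc n) 1)
    (f : Euc n × Euc n → ℝ) (c : ℝ)
    (hf : ContDiffOn ℝ 2 f (closure Ω ×ˢ closure Ωt))
    (hosc : OSCcond Ω Ωt f)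
    (u : Euc n → ℝ) (hu : IsStrictSol Ω Ωt f c u) :
    ∀ x ∈ Ω,
      ((n : ℝ) / 2) * ((volume Ωt).toReal / (volume Ω).toReal) ^ ((1 : ℝ) / n) ≤
          f (x, gradient u x) + c ∧
      ((n : ℝ) / 2) * ((volume Ωt).toReal / (volume Ω).toReal) ^ ((1 : ℝ) / n) ≤
          MinkDiv u x := by
  obtain ⟨hΩ, -, hΩb, hΩtb, hΩne, -⟩ := hdom
  obtain ⟨hu2, hH, hgrad, heq, himage⟩ := hu
  have hn0 : n ≠ 0 := by omega
  have hdiff : ∀ x ∈ Ω, DifferentiableAt ℝ (gradient u) x := fun x hx =>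
    differentiableAt_gradient ((hu2.mono subset_closure).contDiffAt (hΩ.mem_nhds hx))
  have hmem : ∀ x ∈ Ω, gradient u x ∈ closure Ωt := fun x hx =>
    subset_closure (himage ▸ mem_image_of_mem _ hx)
  obtain ⟨x₀, hx₀, hdet⟩ := exists_volume_image_div_le_abs_det_fderiv hΩ hΩne
    hΩb.measure_lt_top.ne (himage ▸ hΩtb.measure_lt_top.ne) hdiff
  have hH₀ := hH x₀ (subset_closure hx₀)
  rw [himage, det_fderiv_gradient (hdiff x₀ hx₀), abs_of_pos hH₀.det_pos] at hdet
  have hmax : (n : ℝ) * ((volume Ωt).toReal / (volume Ω).toReal) ^ ((1 : ℝ) / n) ≤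
      f (x₀, gradient u x₀) + c :=
    calc _ ≤ (n : ℝ) * (Hess u x₀).det ^ ((1 : ℝ) / n) := by gcongr
      _ ≤ (Hess u x₀).trace := hH₀.card_mul_det_rpow_le_trace hn0
      _ ≤ MinkDiv u x₀ := trace_Hess_le_MinkDiv (hdiff x₀ hx₀) (hgrad x₀ (subset_closure hx₀))
          hH₀.posSemidef
      _ = _ := heq x₀ hx₀
  intro x hx
  rw [heq x hx, and_self]
  have hosc₀ := (le_abs_self _).trans (hosc x₀ (subset_closure hx₀) x (subset_closure hx)
    _ (hmem x₀ hx₀) _ (hmem x hx))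
  linarith

end
end

section
/- Assume f satisfies condition (OSC). There exist constants Λ₆, Λ₇ > 0, depending only on n, Ω, Ω̃ and f, such that every strictly convex solution u ∈ C²(Ω̄) of the second boundary value problem with data (f, c) satisfies, for all x ∈ Ω: Λ₆ ≤ trace(S(∇u(x))) ≤ Λ₇ and Λ₆ ≤ trace(S(∇u(x))·(D²u(x))²) ≤ Λ₇. (In an orthonormal eigenbasis of D²u(x) with eigenvalues λᵢ, these two quantities are Σᵢ ∂G/∂λᵢ and Σᵢ (∂G/∂λᵢ)λᵢ² for the operator G(Du, D²u) = Σᵢⱼ S(∇u)ᵢⱼ ∂ᵢⱼu.) -/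
open Set MeasureTheory Matrix
open scoped Topology RealInnerProductSpace NNReal

noncomputable section

variable {n : ℕ}

open scoped MatrixOrder in
theorem exists_eq_conjTranspose_mul_self {A : Matrix (Fin n) (Fin n) ℝ} (hA : A.PosSemidef) :
    ∃ B : Matrix (Fin n) (Fin n) ℝ, A = Bᴴ * B :=
  CStarAlgebra.nonneg_iff_eq_star_mul_self.1 hA.nonneg

theorem quadForm_le_mul_trace {A : Matrix (Fin n) (Fin n) ℝ} (hA : A.PosSemidef)
    (p : Fin n → ℝ) : p ⬝ᵥ A *ᵥ p ≤ (∑ i, p i ^ 2) * A.trace := by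
  obtain ⟨B, rfl⟩ := exists_eq_conjTranspose_mul_self hA
  have hquad : p ⬝ᵥ (Bᴴ * B) *ᵥ p = ∑ k, (∑ j, B k j * p j) ^ 2 := by
    rw [← Matrix.mulVec_mulVec, Matrix.dotProduct_mulVec, Matrix.vecMul_conjTranspose]
    simp [dotProduct, Matrix.mulVec, sq]
  have htrace : (Bᴴ * B).trace = ∑ k, ∑ j, B k j ^ 2 := by
    rw [Finset.sum_comm]
    simp [Matrix.trace, Matrix.mul_apply, sq]
  rw [hquad, htrace, Finset.mul_sum]
  refine Finset.sum_le_sum fun k _ => ?_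
  rw [mul_comm]
  exact Finset.sum_mul_sq_le_sq_mul_sq _ _ _

theorem trace_sq_le_sq_trace {A : Matrix (Fin n) (Fin n) ℝ} (hA : A.PosSemidef) :
    (A ^ 2).trace ≤ A.trace ^ 2 := by
  obtain ⟨B, hB⟩ := exists_eq_conjTranspose_mul_self hA
  have hsq : (A ^ 2).trace = ∑ k, B k ⬝ᵥ A *ᵥ B k := by
    have : (A ^ 2).trace = (B * A * Bᴴ).trace := by
      rw [Matrix.trace_mul_comm, ← Matrix.mul_assoc, ← hB, sq]
    rw [this]
    simp [Matrix.trace, Matrix.mul_apply, dotProduct, Matrix.mulVec, Finset.mul_sum,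
      Finset.sum_mul]
    refine Finset.sum_congr rfl fun k _ => ?_
    rw [Finset.sum_comm]
    exact Finset.sum_congr rfl fun i _ => Finset.sum_congr rfl fun j _ => by ring
  have htrace : A.trace = ∑ k, ∑ j, B k j ^ 2 := by
    rw [Finset.sum_comm, hB]
    simp [Matrix.trace, Matrix.mul_apply, sq]
  calc (A ^ 2).trace = ∑ k, B k ⬝ᵥ A *ᵥ B k := hsq
    _ ≤ ∑ k, (∑ j, B k j ^ 2) * A.trace :=
      Finset.sum_le_sum fun k _ => quadForm_le_mul_trace hA (B k)
    _ = A.trace ^ 2 := by rw [← Finset.sum_mul, ← htrace, sq]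

theorem sq_trace_le_card_mul_trace_sq {A : Matrix (Fin n) (Fin n) ℝ} (hA : A.IsSymm) :
    A.trace ^ 2 ≤ n * (A ^ 2).trace := by
  have hsq : (A ^ 2).trace = ∑ i, ∑ j, A i j ^ 2 := by
    simp only [Matrix.trace, sq, Matrix.diag_apply, Matrix.mul_apply]
    exact Finset.sum_congr rfl fun i _ => Finset.sum_congr rfl fun j _ => by rw [hA.apply]
  have hdiag : ∑ i, A i i ^ 2 ≤ (A ^ 2).trace := by
    rw [hsq]
    exact Finset.sum_le_sum fun i _ => Finset.single_le_sum (f := fun j => A i j ^ 2)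
      (fun j _ => sq_nonneg _) (Finset.mem_univ i)
  calc A.trace ^ 2 ≤ n * ∑ i, A i i ^ 2 := by
        simpa [Matrix.trace] using sq_sum_le_card_mul_sum_sq (s := Finset.univ)
          (f := fun i => A i i)
    _ ≤ _ := by gcongr

/-- The arithmetic-geometric mean inequality for the eigenvalues. -/
theorem det_le_trace_div_pow (hn : n ≠ 0) {A : Matrix (Fin n) (Fin n) ℝ} (hA : A.PosSemidef) :
    A.det ≤ (A.trace / n) ^ n := by
  have hnR : (n : ℝ) ≠ 0 := Nat.cast_ne_zero.2 hn
  have hev := hA.eigenvalues_nonneg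
  have amgm := Real.geom_mean_le_arith_mean Finset.univ (fun _ => 1) hA.1.eigenvalues
    (fun _ _ => zero_le_one) (by simpa using Nat.pos_of_ne_zero hn) (fun i _ => hev i)
  have hprod : 0 ≤ ∏ i, hA.1.eigenvalues i := Finset.prod_nonneg fun i _ => hev i
  simp only [Real.rpow_one, one_mul, Finset.sum_const, Finset.card_univ, Fintype.card_fin,
    nsmul_eq_mul, mul_one] at amgm
  have hdet : A.det = ∏ i, hA.1.eigenvalues i := by simpa using hA.1.det_eq_prod_eigenvalues
  have htr : A.trace = ∑ i, hA.1.eigenvalues i := by simpa using hA.1.trace_eq_sum_eigenvalues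
  rw [hdet, htr]
  calc _ = ((∏ i, hA.1.eigenvalues i) ^ ((n : ℝ)⁻¹)) ^ n :=
        (Real.rpow_inv_natCast_pow hprod hn).symm
    _ ≤ _ := by gcongr

theorem trace_Smat_mul (p : Euc n) (M : Matrix (Fin n) (Fin n) ℝ) :
    (Smat p * M).trace = (Real.sqrt (1 - ‖p‖ ^ 2))⁻¹ *
      (M.trace + (1 - ‖p‖ ^ 2)⁻¹ * ((fun i => p i) ⬝ᵥ M *ᵥ (fun i => p i))) := by
  have : (vecMulVec (fun i => p i) (fun i => p i) * M).trace
      = (fun i => p i) ⬝ᵥ M *ᵥ (fun i => p i) := by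
    rw [Matrix.vecMulVec_mul, Matrix.trace_vecMulVec, Matrix.dotProduct_mulVec, dotProduct_comm]
  simp [Smat, add_mul, this, mul_add]

theorem trace_le_trace_Smat_mul {p : Euc n} (hp : ‖p‖ < 1) {M : Matrix (Fin n) (Fin n) ℝ}
    (hM : M.PosSemidef) : M.trace ≤ (Smat p * M).trace := by
  have hv : 0 < 1 - ‖p‖ ^ 2 := by nlinarith [norm_nonneg p]
  have hquad : 0 ≤ (fun i => p i) ⬝ᵥ M *ᵥ (fun i => p i) := by
    simpa using hM.dotProduct_mulVec_nonneg (fun i => p i)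
  have hinv : 1 ≤ (Real.sqrt (1 - ‖p‖ ^ 2))⁻¹ :=
    (one_le_inv₀ (Real.sqrt_pos.2 hv)).2 (Real.sqrt_le_one.2 (by nlinarith [sq_nonneg ‖p‖]))
  have hq : 0 ≤ (1 - ‖p‖ ^ 2)⁻¹ * ((fun i => p i) ⬝ᵥ M *ᵥ (fun i => p i)) := by positivity
  rw [trace_Smat_mul]
  nlinarith [hM.trace_nonneg]

/-- An upper bound for the eigenvalues of `S(p)` when `‖p‖ ≤ ρ < 1`. -/
def ellipticityBound (ρ : ℝ) : ℝ := (Real.sqrt (1 - ρ ^ 2))⁻¹ * (1 + (1 - ρ ^ 2)⁻¹)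

theorem one_le_ellipticityBound {ρ : ℝ} (hρ₀ : 0 ≤ ρ) (hρ : ρ < 1) : 1 ≤ ellipticityBound ρ := by
  have hv : 0 < 1 - ρ ^ 2 := by nlinarith
  have hinv : 1 ≤ (Real.sqrt (1 - ρ ^ 2))⁻¹ :=
    (one_le_inv₀ (Real.sqrt_pos.2 hv)).2 (Real.sqrt_le_one.2 (by nlinarith [sq_nonneg ρ]))
  have : 0 ≤ (1 - ρ ^ 2)⁻¹ := by positivity
  unfold ellipticityBound
  nlinarith

theorem trace_Smat_mul_le {p : Euc n} {ρ : ℝ} (hpρ : ‖p‖ ≤ ρ) (hρ : ρ < 1)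
    {M : Matrix (Fin n) (Fin n) ℝ} (hM : M.PosSemidef) :
    (Smat p * M).trace ≤ ellipticityBound ρ * M.trace := by
  have hp0 := norm_nonneg p
  have hv : 0 < 1 - ρ ^ 2 := by nlinarith
  have hle : 1 - ρ ^ 2 ≤ 1 - ‖p‖ ^ 2 := by nlinarith
  have hp1 : ‖p‖ ^ 2 ≤ 1 := by nlinarith
  have hnn := hM.trace_nonneg
  have hquad : (fun i => p i) ⬝ᵥ M *ᵥ (fun i => p i) ≤ M.trace := by
    refine (quadForm_le_mul_trace hM _).trans ?_
    rw [← EuclideanSpace.real_norm_sq_eq]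
    exact mul_le_of_le_one_left hnn hp1
  have hquad0 : 0 ≤ (fun i => p i) ⬝ᵥ M *ᵥ (fun i => p i) := by
    simpa using hM.dotProduct_mulVec_nonneg (fun i => p i)
  have h1 : (1 - ‖p‖ ^ 2)⁻¹ ≤ (1 - ρ ^ 2)⁻¹ := inv_anti₀ hv hle
  have h2 : (Real.sqrt (1 - ‖p‖ ^ 2))⁻¹ ≤ (Real.sqrt (1 - ρ ^ 2))⁻¹ :=
    inv_anti₀ (Real.sqrt_pos.2 hv) (Real.sqrt_le_sqrt hle)
  rw [trace_Smat_mul]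
  calc _ ≤ (Real.sqrt (1 - ρ ^ 2))⁻¹ * (M.trace + (1 - ρ ^ 2)⁻¹ * M.trace) := by gcongr
    _ = _ := by unfold ellipticityBound; ring

/-- The Riesz representation, as a linear map over the reals. -/
def rieszCLM (n : ℕ) : StrongDual ℝ (Euc n) →L[ℝ] Euc n where
  toFun := (InnerProductSpace.toDual ℝ (Euc n)).symm
  map_add' := map_add _
  map_smul' a l := by simp
  cont := (InnerProductSpace.toDual ℝ (Euc n)).symm.continuous

/-- The derivative of the gradient map. -/
def gradDeriv (u : Euc n → ℝ) (x : Euc n) : Euc n →L[ℝ] Euc n :=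
  (rieszCLM n).comp (fderiv ℝ (fderiv ℝ u) x)

theorem hasFDerivAt_gradient {u : Euc n → ℝ} {x : Euc n} (hu : ContDiffAt ℝ 2 u x) :
    HasFDerivAt (gradient u) (gradDeriv u x) x := by
  have h1 : ContDiffAt ℝ 1 (fderiv ℝ u) x := hu.fderiv_right (by norm_num)
  exact (rieszCLM n).hasFDerivAt.comp x (h1.differentiableAt one_ne_zero).hasFDerivAt

theorem gradDeriv_single_apply (u : Euc n → ℝ) (x : Euc n) (i j : Fin n) :
    gradDeriv u x (EuclideanSpace.single i 1) j = Hess u x i j := by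
  have h : ⟪gradDeriv u x (EuclideanSpace.single i 1), EuclideanSpace.single j (1 : ℝ)⟫
      = fderiv ℝ (fderiv ℝ u) x (EuclideanSpace.single i 1) (EuclideanSpace.single j 1) :=
    InnerProductSpace.toDual_symm_apply
  rw [Hess, iteratedFDeriv_two_apply]
  simpa [EuclideanSpace.inner_single_right] using h

theorem det_gradDeriv (u : Euc n → ℝ) (x : Euc n) : (gradDeriv u x).det = (Hess u x).det := by
  have h : LinearMap.toMatrix (EuclideanSpace.basisFun (Fin n) ℝ).toBasis
      (EuclideanSpace.basisFun (Fin n) ℝ).toBasis (gradDeriv u x : Euc n →ₗ[ℝ] Euc n)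
      = (Hess u x)ᵀ := by
    ext i j
    simp [LinearMap.toMatrix_apply, gradDeriv_single_apply]
  rw [ContinuousLinearMap.det, ← LinearMap.det_toMatrix
    (EuclideanSpace.basisFun (Fin n) ℝ).toBasis, h, Matrix.det_transpose]

theorem minkDiv_eq_trace {u : Euc n → ℝ} {x : Euc n} (hu : ContDiffAt ℝ 2 u x)
    (hx : ‖gradient u x‖ < 1) : MinkDiv u x = (Smat (gradient u x) * Hess u x).trace := by
  have hv : 0 < 1 - ‖gradient u x‖ ^ 2 := by nlinarith [norm_nonneg (gradient u x)]
  have hg := hasFDerivAt_gradient hu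
  have hs : HasFDerivAt (fun y => (Real.sqrt (1 - ‖gradient u y‖ ^ 2))⁻¹) _ x :=
    (hasDerivAt_inv (Real.sqrt_pos.2 hv).ne').comp_hasFDerivAt x
    ((hg.norm_sq.const_sub 1).sqrt hv.ne')
  have hterm : ∀ i, fderiv ℝ
      (fun y => (Real.sqrt (1 - ‖gradient u y‖ ^ 2))⁻¹ * gradient u y i) x
        (EuclideanSpace.single i 1) =
      (Real.sqrt (1 - ‖gradient u x‖ ^ 2))⁻¹ * Hess u x i i +
      (Real.sqrt (1 - ‖gradient u x‖ ^ 2))⁻¹ * (1 - ‖gradient u x‖ ^ 2)⁻¹ *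
        (gradient u x i * ∑ j, Hess u x i j * gradient u x j) := by
    intro i
    have hi : HasFDerivAt (fun y => gradient u y i)
        ((EuclideanSpace.proj i : Euc n →L[ℝ] ℝ).comp (gradDeriv u x)) x :=
      (EuclideanSpace.proj i : Euc n →L[ℝ] ℝ).hasFDerivAt.comp x hg
    rw [(hs.fun_mul hi).fderiv]
    have hin : ⟪gradient u x, gradDeriv u x (EuclideanSpace.single i 1)⟫
        = ∑ j, Hess u x i j * gradient u x j := by
      rw [PiLp.inner_apply]
      simp [gradDeriv_single_apply]
    have hsq : Real.sqrt (1 - ‖gradient u x‖ ^ 2) ^ 2 = 1 - ‖gradient u x‖ ^ 2 :=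
      Real.sq_sqrt hv.le
    have hsp := Real.sqrt_pos.2 hv
    have hdiag : (EuclideanSpace.proj i : Euc n →L[ℝ] ℝ)
        (gradDeriv u x (EuclideanSpace.single i 1)) = Hess u x i i :=
      gradDeriv_single_apply u x i i
    simp only [_root_.add_apply, _root_.smul_apply,
      _root_.neg_apply, ContinuousLinearMap.comp_apply, innerSL_apply_apply, hin,
      hdiag, smul_eq_mul, nsmul_eq_mul, hsq]
    push_cast
    field_simp
  rw [MinkDiv, Finset.sum_congr rfl fun i _ => hterm i, trace_Smat_mul, Finset.sum_add_distrib,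
    ← Finset.mul_sum, ← Finset.mul_sum]
  simp only [Matrix.trace, Matrix.diag_apply, dotProduct, Matrix.mulVec]
  ring

/-- The second-order necessary condition at a maximum. -/
theorem IsLocalMax.deriv_deriv_nonpos {g : ℝ → ℝ} {a : ℝ} (hg : IsLocalMax g a)
    (hc : ContinuousAt g a) : deriv (deriv g) a ≤ 0 := by
  by_contra! hpos
  have hmin := isLocalMin_of_deriv_deriv_pos hpos hg.deriv_eq_zero hc
  have hconst : g =ᶠ[𝓝 a] fun _ => g a := by
    filter_upwards [hg, hmin] with s h1 h2 using le_antisymm h1 h2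
  have : deriv (deriv g) a = 0 := by
    rw [hconst.deriv.deriv_eq]; simp
  exact hpos.ne' this

theorem hess_diag_le_of_isLocalMax {u : Euc n → ℝ} {y x₀ : Euc n} {K : ℝ}
    (hu : ContDiffAt ℝ 2 u y)
    (hmax : IsLocalMax (fun z => u z - K / 2 * ‖z - x₀‖ ^ 2) y) (i : Fin n) :
    Hess u y i i ≤ K := by
  set e : Euc n := EuclideanSpace.single i 1 with he
  have hline (s : ℝ) : HasDerivAt (fun s : ℝ => y + s • e) e s := by
    simpa using ((hasDerivAt_id s).smul_const e).const_add y
  have hcont : ContinuousAt (fun s : ℝ => y + s • e) 0 := (hline 0).continuousAt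
  have htend : Filter.Tendsto (fun s : ℝ => y + s • e) (𝓝 0) (𝓝 y) := by
    simpa [ContinuousAt] using hcont
  have hev : ∀ᶠ z in 𝓝 y, ContDiffAt ℝ 2 u z := hu.eventually (by simp)
  have hderiv : ∀ᶠ s in 𝓝 (0 : ℝ),
      HasDerivAt (fun s : ℝ => u (y + s • e) - K / 2 * ‖y + s • e - x₀‖ ^ 2)
        (gradient u (y + s • e) i - K * (y + s • e - x₀) i) s := by
    filter_upwards [htend.eventually hev] with s hs
    have h1 := (hs.differentiableAt two_ne_zero).hasFDerivAt.comp_hasDerivAt s (hline s)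
    have h2 := (((hline s).sub_const x₀).norm_sq).const_mul (K / 2)
    refine (h1.sub h2).congr_deriv ?_
    have h3 : fderiv ℝ u (y + s • e) e = gradient u (y + s • e) i := by
      rw [← inner_gradient_left, he, EuclideanSpace.inner_single_right]; simp
    rw [h3, he, EuclideanSpace.inner_single_right]
    simp
    ring
  have hfst : deriv (fun s : ℝ => u (y + s • e) - K / 2 * ‖y + s • e - x₀‖ ^ 2) =ᶠ[𝓝 0]
      fun s => gradient u (y + s • e) i - K * (y + s • e - x₀) i := by
    filter_upwards [hderiv] with s hs using hs.deriv
  have hsnd : HasDerivAt (fun s : ℝ => gradient u (y + s • e) i - K * (y + s • e - x₀) i)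
      (Hess u y i i - K) 0 := by
    have hg : HasFDerivAt (gradient u) (gradDeriv u y) (y + (0 : ℝ) • e) := by
      simpa using hasFDerivAt_gradient hu
    have h1 := (EuclideanSpace.proj i : Euc n →L[ℝ] ℝ).hasFDerivAt.comp_hasDerivAt (0 : ℝ)
      (hg.comp_hasDerivAt (0 : ℝ) (hline 0))
    have h2 := ((EuclideanSpace.proj i : Euc n →L[ℝ] ℝ).hasFDerivAt.comp_hasDerivAt (0 : ℝ)
      ((hline 0).sub_const x₀)).const_mul K
    refine (h1.sub h2).congr_deriv ?_
    simp [he, gradDeriv_single_apply]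
  have hmax' : IsLocalMax (fun s : ℝ => u (y + s • e) - K / 2 * ‖y + s • e - x₀‖ ^ 2) 0 := by
    have := htend.eventually hmax
    filter_upwards [this] with s hs
    simpa using hs
  have := hmax'.deriv_deriv_nonpos hderiv.self_of_nhds.continuousAt
  rw [hfst.deriv_eq, hsnd.deriv] at this
  linarith

/-- A function with gradient bounded by one on a ball has controlled second derivatives at some
point of that ball. -/
theorem exists_trace_hess_le {u : Euc n → ℝ} {x₀ : Euc n} {r : ℝ} (hr : 0 < r)
    (hu : ∀ x ∈ Metric.closedBall x₀ r, ContDiffAt ℝ 2 u x)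
    (hgrad : ∀ x ∈ Metric.closedBall x₀ r, ‖gradient u x‖ ≤ 1) :
    ∃ y ∈ Metric.closedBall x₀ r, (Hess u y).trace ≤ n * (3 / r) := by
  have hcont : ContinuousOn (fun z => u z - (3 / r) / 2 * ‖z - x₀‖ ^ 2)
      (Metric.closedBall x₀ r) := by
    refine ContinuousOn.sub (fun z hz => (hu z hz).continuousAt.continuousWithinAt) ?_
    fun_prop
  have hx₀ : x₀ ∈ Metric.closedBall x₀ r := Metric.mem_closedBall_self hr.le
  obtain ⟨y, hy, hmax⟩ := (isCompact_closedBall x₀ r).exists_isMaxOn ⟨x₀, hx₀⟩ hcont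
  have hlip : ‖u y - u x₀‖ ≤ 1 * ‖y - x₀‖ := by
    refine (convex_closedBall x₀ r).norm_image_sub_le_of_norm_fderiv_le
      (fun z hz => (hu z hz).differentiableAt two_ne_zero) (fun z hz => ?_) hx₀ hy
    rw [← toDual_gradient, LinearIsometryEquiv.norm_map]
    exact hgrad z hz
  have hyr : ‖y - x₀‖ < r := by
    refine lt_of_le_of_ne (by simpa [dist_eq_norm] using hy) fun heq => ?_
    have h1 := hmax hx₀
    simp only [Set.mem_ofPred_eq, sub_self, norm_zero, heq] at h1
    have h2 := (abs_le.1 hlip).2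
    rw [heq] at h2
    have h3 : 3 / r / 2 * r ^ 2 = 3 / 2 * r := by field_simp
    rw [h3] at h1
    norm_num at h1
    linarith
  have hloc := hmax.isLocalMax (Metric.closedBall_mem_nhds_of_mem (by simpa [dist_eq_norm]))
  refine ⟨y, hy, ?_⟩
  calc (Hess u y).trace ≤ ∑ _i : Fin n, 3 / r :=
        Finset.sum_le_sum fun i _ => hess_diag_le_of_isLocalMax (hu y hy) hloc i
    _ = _ := by simp

/-- The volume of the gradient image is controlled by a bound on the Laplacian. -/
theorem volume_gradient_image_le (hn : n ≠ 0) {Ω : Set (Euc n)} (hΩ : MeasurableSet Ω)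
    (hfin : volume Ω ≠ ⊤) {u : Euc n → ℝ} (hu : ∀ x ∈ Ω, ContDiffAt ℝ 2 u x)
    (hpos : ∀ x ∈ Ω, (Hess u x).PosSemidef) {s : ℝ} (hs0 : 0 ≤ s)
    (hs : ∀ x ∈ Ω, (Hess u x).trace ≤ s) :
    (volume (gradient u '' Ω)).toReal ≤ (s / n) ^ n * (volume Ω).toReal := by
  have hle : volume (gradient u '' Ω) ≤ ENNReal.ofReal ((s / n) ^ n) * volume Ω := by
    calc volume (gradient u '' Ω)
        ≤ ∫⁻ x in Ω, ENNReal.ofReal |(gradDeriv u x).det| :=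
          addHaar_image_le_lintegral_abs_det_fderiv volume hΩ
            fun x hx => (hasFDerivAt_gradient (hu x hx)).hasFDerivWithinAt
      _ ≤ ∫⁻ _ in Ω, ENNReal.ofReal ((s / n) ^ n) := by
          refine setLIntegral_mono measurable_const fun x hx => ENNReal.ofReal_le_ofReal ?_
          have htr := (hpos x hx).trace_nonneg
          rw [det_gradDeriv, abs_of_nonneg (hpos x hx).det_nonneg]
          refine (det_le_trace_div_pow hn (hpos x hx)).trans ?_
          have := hs x hx
          gcongr
      _ = _ := setLIntegral_const _ _
  have htop : ENNReal.ofReal ((s / n) ^ n) * volume Ω ≠ ⊤ :=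
    ENNReal.mul_ne_top ENNReal.ofReal_ne_top hfin
  have := ENNReal.toReal_mono htop hle
  rwa [ENNReal.toReal_mul, ENNReal.toReal_ofReal (by positivity)] at this

theorem statement_5 {n : ℕ} (hn : 2 ≤ n)
    (Ω Ωt : Set (Euc n)) (ht h : Euc n → ℝ) (θt θ : ℝ)
    (hdom : DomainSetup Ω Ωt ht h θt θ)
    (hball : closure Ωt ⊆ Metric.ball (0 : Euc n) 1)
    (f : Euc n × Euc n → ℝ)
    (hf : ContDiffOn ℝ 2 f (closure Ω ×ˢ closure Ωt))
    (hosc : OSCcond Ω Ωt f) :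
    ∃ Λ₆ Λ₇ : ℝ, 0 < Λ₆ ∧ 0 < Λ₇ ∧
      ∀ (c : ℝ) (u : Euc n → ℝ), IsStrictSol Ω Ωt f c u → ∀ x ∈ Ω,
        (Λ₆ ≤ (Smat (gradient u x)).trace ∧ (Smat (gradient u x)).trace ≤ Λ₇) ∧
        (Λ₆ ≤ (Smat (gradient u x) * Hess u x ^ 2).trace ∧
          (Smat (gradient u x) * Hess u x ^ 2).trace ≤ Λ₇) := by
  obtain ⟨hΩo, hΩto, hΩb, hΩtb, hΩne, hΩtne, -⟩ := hdom
  have hn0 : n ≠ 0 := by omega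
  have hnR : (1 : ℝ) ≤ n := by exact_mod_cast (by omega : 1 ≤ n)
  obtain ⟨ρ, hρ0, hρ1, hρ⟩ : ∃ ρ : ℝ, 0 ≤ ρ ∧ ρ < 1 ∧ ∀ p ∈ Ωt, ‖p‖ ≤ ρ := by
    obtain ⟨q, hq, hmax⟩ := (hΩtb.isCompact_closure).exists_isMaxOn hΩtne.closure
      continuous_norm.continuousOn
    exact ⟨‖q‖, norm_nonneg q, by simpa using hball hq, fun p hp => hmax (subset_closure hp)⟩
  obtain ⟨x₀, hx₀⟩ := hΩne
  obtain ⟨r, hr, hrΩ⟩ := Metric.nhds_basis_closedBall.mem_iff.1 (hΩo.mem_nhds hx₀)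
  set a : ℝ := (volume Ωt).toReal / (volume Ω).toReal with ha
  have hΩfin : volume Ω ≠ ⊤ := hΩb.measure_lt_top.ne
  have hΩpos : 0 < (volume Ω).toReal :=
    ENNReal.toReal_pos (hΩo.measure_pos volume ⟨x₀, hx₀⟩).ne' hΩfin
  have hΩtpos : 0 < (volume Ωt).toReal :=
    ENNReal.toReal_pos (hΩto.measure_pos volume hΩtne).ne' hΩtb.measure_lt_top.ne
  have ha0 : 0 < a := div_pos hΩtpos hΩpos
  set m : ℝ := n / 2 * a ^ ((1 : ℝ) / n) with hm
  have hm0 : 0 < m := by positivity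
  set C : ℝ := ellipticityBound ρ with hC
  have hC1 : 1 ≤ C := one_le_ellipticityBound hρ0 hρ1
  set U : ℝ := C * (n * (3 / r)) + m with hU
  have hU0 : 0 < U := by positivity
  refine ⟨min 1 ((m / C) ^ 2 / n), max (C * n) (C * U ^ 2), by positivity, by positivity, ?_⟩
  rintro c u ⟨hu, hH, hgrad, heq, himg⟩
  have huat (x) (hx : x ∈ Ω) : ContDiffAt ℝ 2 u x :=
    hu.contDiffAt (Filter.mem_of_superset (hΩo.mem_nhds hx) subset_closure)
  have hpos (x) (hx : x ∈ Ω) : (Hess u x).PosSemidef := (hH x (subset_closure hx)).posSemidef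
  have hmem (x) (hx : x ∈ Ω) : gradient u x ∈ Ωt := himg ▸ mem_image_of_mem _ hx
  have hg1 (x) (hx : x ∈ Ω) : ‖gradient u x‖ < 1 := hgrad x (subset_closure hx)
  have hpde (x) (hx : x ∈ Ω) :
      (Smat (gradient u x) * Hess u x).trace = f (x, gradient u x) + c := by
    rw [← minkDiv_eq_trace (huat x hx) (hg1 x hx), heq x hx]
  have hosc' (x) (hx : x ∈ Ω) (y) (hy : y ∈ Ω) :
      (Smat (gradient u x) * Hess u x).trace ≤ (Smat (gradient u y) * Hess u y).trace + m := by
    rw [hpde x hx, hpde y hy]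
    have := (abs_le.1 (hosc x (subset_closure hx) y (subset_closure hy) _
      (subset_closure (hmem x hx)) _ (subset_closure (hmem y hy)))).2
    linarith
  have htrle (x) (hx : x ∈ Ω) : (Hess u x).trace ≤ (Smat (gradient u x) * Hess u x).trace :=
    trace_le_trace_Smat_mul (hg1 x hx) (hpos x hx)
  have hleC (x) (hx : x ∈ Ω) : (Smat (gradient u x) * Hess u x).trace ≤ C * (Hess u x).trace :=
    trace_Smat_mul_le (hρ _ (hmem x hx)) hρ1 (hpos x hx)
  have hlower (x) (hx : x ∈ Ω) : m ≤ (Smat (gradient u x) * Hess u x).trace := by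
    by_contra! hlt
    set s := (Smat (gradient u x) * Hess u x).trace + m with hs
    have hs0 : 0 ≤ s := by
      have := (hpos x hx).trace_nonneg.trans (htrle x hx)
      positivity
    have hvol := volume_gradient_image_le hn0 hΩo.measurableSet hΩfin huat hpos hs0
      fun y hy => (htrle y hy).trans (hosc' y hy x hx)
    rw [himg, ← div_le_iff₀ hΩpos, ← ha] at hvol
    have hroot : s / n < a ^ ((1 : ℝ) / n) := by
      rw [div_lt_iff₀ (by positivity)]
      linarith
    have hpow : (s / n) ^ n < a := by
      calc (s / n) ^ n < (a ^ ((1 : ℝ) / n)) ^ n := by gcongr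
        _ = a := by rw [one_div, Real.rpow_inv_natCast_pow ha0.le hn0]
    linarith
  have hupper (x) (hx : x ∈ Ω) : (Smat (gradient u x) * Hess u x).trace ≤ U := by
    obtain ⟨y, hy, hyle⟩ := exists_trace_hess_le hr (fun z hz => huat z (hrΩ hz))
      fun z hz => (hg1 z (hrΩ hz)).le
    calc _ ≤ (Smat (gradient u y) * Hess u y).trace + m := hosc' x hx y (hrΩ hy)
      _ ≤ C * (Hess u y).trace + m := by gcongr; exact hleC y (hrΩ hy)
      _ ≤ U := by rw [hU]; gcongr
  intro x hx
  have hone : (1 : Matrix (Fin n) (Fin n) ℝ).PosSemidef := .one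
  have htr0 := (hpos x hx).trace_nonneg
  have hsq : (Hess u x ^ 2).PosSemidef := (hpos x hx).pow 2
  refine ⟨⟨?_, ?_⟩, ?_, ?_⟩
  · have := trace_le_trace_Smat_mul (hg1 x hx) hone
    rw [mul_one, Matrix.trace_one, Fintype.card_fin] at this
    exact (min_le_left _ _).trans (hnR.trans this)
  · have := trace_Smat_mul_le (hρ _ (hmem x hx)) hρ1 hone
    rw [mul_one, Matrix.trace_one, Fintype.card_fin] at this
    exact this.trans (le_max_left _ _)
  · refine (min_le_right _ _).trans (le_trans ?_ (trace_le_trace_Smat_mul (hg1 x hx) hsq))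
    rw [div_le_iff₀ (by positivity), mul_comm]
    refine le_trans ?_ (sq_trace_le_card_mul_trace_sq (hpos x hx).1)
    have : m / C ≤ (Hess u x).trace := by
      rw [div_le_iff₀ (by positivity), mul_comm]
      exact (hlower x hx).trans (hleC x hx)
    gcongr
  · refine (trace_Smat_mul_le (hρ _ (hmem x hx)) hρ1 hsq).trans (le_trans ?_ (le_max_right _ _))
    have := (htrle x hx).trans (hupper x hx)
    gcongr
    exact (trace_sq_le_sq_trace (hpos x hx)).trans (by gcongr)

end
end
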